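/- For every real γ > 0, the function F(t) = Σ_{k=0}^n e^{γ·(ν_k(t))²}, where ν_0(t), …, ν_n(t) are the n+1 real roots of the equation P(z) − t·Q(z) = 0, is exponentially convex on (−∞, ∞). -/

import Mathlib

open Polynomial ComplexOrder

/-- A function `f` is exponentially convex on the set `S` if it is continuous on `S` and
for every `N`, reals `t 1, …, t N` with all pairwise sums in `S`, and complex `ζ 1, …, ζ N`,
the quadratic form `∑ f (t r + t s) ζ r conj (ζ s)` is real and nonnegative. -/
def ExpConvexOn (f : ℝ → ℝ) (S : Set ℝ) : Prop :=
  ContinuousOn f S ∧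
  ∀ (N : ℕ) (t : Fin N → ℝ), (∀ r s, t r + t s ∈ S) →
    ∀ ζ : Fin N → ℂ,
      (0 : ℂ) ≤ ∑ r, ∑ s, (f (t r + t s) : ℂ) * ζ r * (starRingEnd ℂ) (ζ s)

section ExponentialConvexity

open Matrix Filter Topology MeasureTheory ProbabilityTheory

section PosSemidef

variable {m : Type*} [Fintype m]

theorem posSemidef_real_iff {M : Matrix m m ℝ} :
    M.PosSemidef ↔ (∀ r s, M r s = M s r) ∧ ∀ x : m → ℝ, 0 ≤ ∑ r, ∑ s, M r s * x r * x s := by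
  rw [posSemidef_iff_dotProduct_mulVec]
  refine and_congr ?_ (forall_congr' fun x => ?_)
  · rw [Matrix.IsHermitian.ext_iff]
    exact ⟨fun h r s => (h s r), fun h r s => h s r⟩
  · simp only [star_trivial, dotProduct, mulVec, Finset.mul_sum]
    simp only [mul_left_comm, mul_assoc]

theorem posSemidef_const {a : ℝ} (ha : 0 ≤ a) : (of fun _ _ : m => a).PosSemidef := by
  refine posSemidef_real_iff.2 ⟨fun _ _ => rfl, fun x => ?_⟩
  have h : ∑ r, ∑ s, (of fun _ _ : m => a) r s * x r * x s = a * (∑ r, x r) ^ 2 := by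
    rw [sq, Finset.sum_mul_sum, Finset.mul_sum]
    simp only [of_apply, Finset.mul_sum, mul_assoc]
  rw [h]
  positivity

theorem posSemidef_of_tendsto {l : Filter ℕ} [l.NeBot] {M : ℕ → Matrix m m ℝ} {L : Matrix m m ℝ}
    (hM : ∀ᶠ k in l, (M k).PosSemidef)
    (hL : ∀ r s, Tendsto (fun k => M k r s) l (𝓝 (L r s))) : L.PosSemidef := by
  refine posSemidef_real_iff.2 ⟨fun r s => ?_, fun x => ?_⟩
  · refine tendsto_nhds_unique (hL r s) ((hL s r).congr' ?_)
    filter_upwards [hM] with k hk using (posSemidef_real_iff.1 hk).1 s r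
  · refine ge_of_tendsto (tendsto_finsetSum _ fun r _ => tendsto_finsetSum _ fun s _ =>
      ((hL r s).mul_const (x r)).mul_const (x s)) ?_
    filter_upwards [hM] with k hk using (posSemidef_real_iff.1 hk).2 x

theorem posSemidef_integral {Ω : Type*} [MeasurableSpace Ω] {P : Measure Ω}
    {M : Ω → Matrix m m ℝ} (hM : ∀ ω, (M ω).PosSemidef)
    (h_int : ∀ r s, Integrable (fun ω => M ω r s) P) :
    (of fun r s => ∫ ω, M ω r s ∂P).PosSemidef := by
  refine posSemidef_real_iff.2 ⟨fun r s => ?_, fun x => ?_⟩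
  · exact integral_congr_ae (ae_of_all _ fun ω => (posSemidef_real_iff.1 (hM ω)).1 r s)
  · have h : ∑ r, ∑ s, (of fun r s => ∫ ω, M ω r s ∂P) r s * x r * x s
        = ∫ ω, ∑ r, ∑ s, M ω r s * x r * x s ∂P := by
      rw [integral_finsetSum _ fun r _ => integrable_finsetSum _ fun s _ =>
        ((h_int r s).mul_const _).mul_const _]
      refine Finset.sum_congr rfl fun r _ => ?_
      rw [integral_finsetSum _ fun s _ => ((h_int r s).mul_const _).mul_const _]
      simp only [integral_mul_const, of_apply]
    rw [h]
    exact integral_nonneg fun ω => (posSemidef_real_iff.1 (hM ω)).2 x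

/-- The Cauchy matrix of positive numbers is positive semidefinite. -/
theorem posSemidef_inv_add {y : m → ℝ} (hy : ∀ r, 0 < y r) :
    (of fun r s => (y r + y s)⁻¹).PosSemidef := by
  have h := posSemidef_integral (P := volume.restrict (Set.Ioi (0 : ℝ)))
    (M := fun u => of fun r s => Real.exp (-(y r + y s) * u)) (fun u => ?_)
    fun r s => integrableOn_exp_mul_Ioi (by linarith [hy r, hy s]) 0
  · convert! h using 1
    ext r s
    simp only [of_apply]
    rw [integral_exp_mul_Ioi (by linarith [hy r, hy s])]
    simp [neg_div, ← inv_neg, add_comm]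
  · refine posSemidef_real_iff.2 ⟨fun r s => by simp [add_comm], fun x => ?_⟩
    have h : ∑ r, ∑ s, (of fun r s => Real.exp (-(y r + y s) * u)) r s * x r * x s
        = (∑ r, Real.exp (-y r * u) * x r) ^ 2 := by
      rw [sq, Finset.sum_mul_sum]
      refine Finset.sum_congr rfl fun r _ => Finset.sum_congr rfl fun s _ => ?_
      rw [of_apply, neg_add, add_mul, Real.exp_add]
      ring
    rw [h]
    positivity

/-- If all entries of a matrix-valued kernel are positive semidefinite kernels, so are all entries
of its pointwise powers. -/
theorem posSemidef_pow_apply {κ : Type*} [Fintype κ] [DecidableEq κ]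
    {A : m → m → Matrix κ κ ℝ} (hA : ∀ i j, (of fun r s => A r s i j).PosSemidef) (p : ℕ) (i j : κ) :
    (of fun r s => (A r s ^ p) i j).PosSemidef := by
  induction p generalizing i j with
  | zero =>
    simp only [pow_zero]
    refine posSemidef_const ?_
    rw [one_apply]
    split_ifs <;> norm_num
  | succ p ih =>
    have h := posSemidef_sum Finset.univ fun k (_ : k ∈ Finset.univ) => (ih i k).hadamard (hA k j)
    convert! h using 1
    ext r s
    simp [pow_succ, mul_apply, Matrix.sum_apply]

theorem complex_quadraticForm_nonneg {M : Matrix m m ℝ} (hM : M.PosSemidef) (ζ : m → ℂ) :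
    0 ≤ ∑ r, ∑ s, (M r s : ℂ) * ζ r * (starRingEnd ℂ) (ζ s) := by
  obtain ⟨hsymm, hpos⟩ := posSemidef_real_iff.1 hM
  rw [Complex.nonneg_iff]
  constructor
  · have h := add_nonneg (hpos fun r => (ζ r).re) (hpos fun r => (ζ r).im)
    simp only [← Finset.sum_add_distrib] at h
    convert! h using 1
    simp only [Complex.re_sum]
    refine Finset.sum_congr rfl fun r _ => Finset.sum_congr rfl fun s _ => ?_
    simp
  · have h : ∑ r, ∑ s, M r s * (ζ r).im * (ζ s).re = ∑ r, ∑ s, M r s * (ζ r).re * (ζ s).im := by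
      rw [Finset.sum_comm]
      refine Finset.sum_congr rfl fun r _ => Finset.sum_congr rfl fun s _ => ?_
      rw [hsymm s r]
      ring
    rw [eq_comm, ← sub_eq_zero] at h
    rw [← neg_eq_zero.2 h]
    simp only [Complex.im_sum, ← Finset.sum_sub_distrib, ← Finset.sum_neg_distrib]
    refine Finset.sum_congr rfl fun r _ => Finset.sum_congr rfl fun s _ => ?_
    simp
    ring

end PosSemidef

section Eigenbasis

variable {κ : Type*} [Fintype κ] [DecidableEq κ] {M : Matrix κ κ ℝ} {θ : κ → ℝ} {v : κ → κ → ℝ}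

theorem exists_units_conj_diagonal (hθ : Function.Injective θ) (hv : ∀ k, v k ≠ 0)
    (hM : ∀ k, M *ᵥ v k = θ k • v k) :
    ∃ V : (Matrix κ κ ℝ)ˣ, M = V * diagonal θ * (V⁻¹ : (Matrix κ κ ℝ)ˣ) := by
  have hli : LinearIndependent ℝ v :=
    Module.End.eigenvectors_linearIndependent' (toLin' M) θ hθ v fun k =>
      ⟨Module.End.mem_eigenspace_iff.2 (by rw [toLin'_apply, hM k]), hv k⟩
  have hu : IsUnit (of v)ᵀ :=
    linearIndependent_cols_iff_isUnit.1 (by simpa [Matrix.col] using! hli)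
  obtain ⟨V, hV⟩ := hu
  refine ⟨V, ?_⟩
  rw [Units.eq_mul_inv_iff_mul_eq, hV]
  ext i k
  have h := congrFun (hM k) i
  simp only [mulVec, dotProduct, Pi.smul_apply, smul_eq_mul] at h
  rw [mul_diagonal, mul_apply, transpose_apply, of_apply, mul_comm, ← h]
  rfl

theorem trace_pow_eq_sum (hθ : Function.Injective θ) (hv : ∀ k, v k ≠ 0)
    (hM : ∀ k, M *ᵥ v k = θ k • v k) (p : ℕ) : (M ^ p).trace = ∑ k, θ k ^ p := by
  obtain ⟨V, rfl⟩ := exists_units_conj_diagonal hθ hv hM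
  rw [Units.conj_pow, trace_units_conj, diagonal_pow, trace_diagonal]
  rfl

theorem trace_exp_smul_sq_eq_sum (hθ : Function.Injective θ) (hv : ∀ k, v k ≠ 0)
    (hM : ∀ k, M *ᵥ v k = θ k • v k) (γ : ℝ) :
    (NormedSpace.exp (γ • M ^ 2)).trace = ∑ k, Real.exp (γ * θ k ^ 2) := by
  obtain ⟨V, rfl⟩ := exists_units_conj_diagonal hθ hv hM
  rw [Units.conj_pow, ← smul_mul_assoc, ← mul_smul_comm, Matrix.exp_units_conj, trace_units_conj,
    diagonal_pow, ← diagonal_smul, Matrix.exp_diagonal, trace_diagonal]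
  simp [Real.exp_eq_exp_ℝ, Pi.coe_exp]

open scoped Matrix.Norms.Operator in
theorem continuous_trace_exp_smul_sq {A : ℝ → Matrix κ κ ℝ} (hA : Continuous A) (γ : ℝ) :
    Continuous fun t => (NormedSpace.exp (γ • A t ^ 2)).trace := by
  have h : Continuous fun t => NormedSpace.exp (γ • A t ^ 2) :=
    NormedSpace.exp_continuous.comp ((hA.pow 2).const_smul γ)
  exact h.matrix_trace

end Eigenbasis

section Arrowhead

variable {ι : Type*} {μ α : ι → ℝ}

/-- The matrix with diagonal entries `t` and `μ`, first row `α`, first column `1` and zeros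
elsewhere; its eigenvalues are the roots of `z - ∑ α k / (z - μ k) = t`. -/
def arrowhead [DecidableEq ι] (μ α : ι → ℝ) (t : ℝ) : Matrix (Option ι) (Option ι) ℝ :=
  of fun i j => i.elim (j.elim t α) fun i => j.elim 1 fun j => diagonal μ i j

/-- The resolvent at `z` of the arrowhead matrix. -/
noncomputable def arrowheadResolvent [Fintype ι] [DecidableEq ι] (μ α : ι → ℝ) (z t : ℝ) :
    Matrix (Option ι) (Option ι) ℝ :=
  diagonal (fun i => i.elim 0 fun i => (z - μ i)⁻¹) +
    (z - ∑ k, α k / (z - μ k) - t)⁻¹ •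
      vecMulVec (fun i => i.elim 1 fun i => (z - μ i)⁻¹) fun i => i.elim 1 fun i => α i / (z - μ i)

/-- The eigenvector of the arrowhead matrix for the eigenvalue `ν`. -/
noncomputable def arrowheadEigenvector (μ : ι → ℝ) (ν : ℝ) : Option ι → ℝ :=
  fun i => i.elim 1 fun i => (ν - μ i)⁻¹

theorem arrowheadEigenvector_ne_zero (ν : ℝ) : arrowheadEigenvector μ ν ≠ 0 :=
  fun h => one_ne_zero (congrFun h none)

theorem continuous_arrowhead [DecidableEq ι] : Continuous (arrowhead μ α) := by
  refine continuous_matrix fun i j => ?_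
  rcases i with _ | i <;> rcases j with _ | j <;> simp only [arrowhead, of_apply, Option.elim] <;>
    fun_prop

theorem arrowhead_mulVec_eigenvector [Fintype ι] [DecidableEq ι] {ν t : ℝ} (hν : ∀ k, ν ≠ μ k)
    (ht : ν - t = ∑ k, α k / (ν - μ k)) :
    arrowhead μ α t *ᵥ arrowheadEigenvector μ ν = ν • arrowheadEigenvector μ ν := by
  ext i
  simp only [mulVec, dotProduct, Fintype.sum_option, Pi.smul_apply, smul_eq_mul]
  rcases i with _ | i
  · simp only [arrowhead, arrowheadEigenvector, of_apply, Option.elim, ← div_eq_mul_inv, ← ht]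
    ring
  · simp only [arrowhead, arrowheadEigenvector, of_apply, Option.elim, diagonal_apply, ite_mul,
      zero_mul, Finset.sum_ite_eq, Finset.mem_univ, if_true]
    have := sub_ne_zero.2 (hν i)
    field_simp
    ring

theorem sub_mul_one_add_sum [Fintype ι] {ν t z : ℝ} (hν : ∀ k, ν ≠ μ k) (hz : ∀ k, z ≠ μ k)
    (ht : ν - t = ∑ k, α k / (ν - μ k)) :
    (z - ν) * (1 + ∑ k, α k / (z - μ k) * (ν - μ k)⁻¹) = z - ∑ k, α k / (z - μ k) - t := by
  have h : (z - ν) * ∑ k, α k / (z - μ k) * (ν - μ k)⁻¹ =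
      ∑ k, α k / (ν - μ k) - ∑ k, α k / (z - μ k) := by
    rw [Finset.mul_sum, ← Finset.sum_sub_distrib]
    refine Finset.sum_congr rfl fun k _ => ?_
    have h1 := sub_ne_zero.2 (hν k)
    have h2 := sub_ne_zero.2 (hz k)
    field_simp
    ring
  rw [mul_add, h, ← ht]
  ring

theorem arrowheadResolvent_mulVec_eigenvector [Fintype ι] [DecidableEq ι] {ν t z : ℝ}
    (hν : ∀ k, ν ≠ μ k) (hz : ∀ k, z ≠ μ k)
    (ht : ν - t = ∑ k, α k / (ν - μ k)) (hc : z - ∑ k, α k / (z - μ k) - t ≠ 0) :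
    arrowheadResolvent μ α z t *ᵥ arrowheadEigenvector μ ν =
      (z - ν)⁻¹ • arrowheadEigenvector μ ν := by
  have key := sub_mul_one_add_sum hν hz ht
  have hzν : z - ν ≠ 0 := fun h => hc (by rw [← key, h, zero_mul])
  have hsum : (z - ∑ k, α k / (z - μ k) - t)⁻¹ * (1 + ∑ k, α k / (z - μ k) * (ν - μ k)⁻¹) =
      (z - ν)⁻¹ := by
    rw [inv_mul_eq_iff_eq_mul₀ hc, ← key]
    field_simp
  have hdot : (fun i : Option ι => i.elim 1 fun i => α i / (z - μ i)) ⬝ᵥ arrowheadEigenvector μ ν =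
      1 + ∑ k, α k / (z - μ k) * (ν - μ k)⁻¹ := by
    simp [dotProduct, Fintype.sum_option, arrowheadEigenvector]
  ext i
  rw [arrowheadResolvent, add_mulVec, smul_mulVec, vecMulVec_mulVec, hdot]
  simp only [Pi.add_apply, mulVec_diagonal, Pi.smul_apply, smul_eq_mul,
    MulOpposite.smul_eq_mul_unop, MulOpposite.unop_op]
  rw [mul_left_comm, hsum]
  rcases i with _ | i
  · simp [arrowheadEigenvector]
  · simp only [arrowheadEigenvector, Option.elim]
    have h1 := sub_ne_zero.2 (hν i)
    have h2 := sub_ne_zero.2 (hz i)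
    field_simp
    ring

theorem posSemidef_arrowheadResolvent_apply [Fintype ι] [DecidableEq ι] {m : Type*} [Fintype m]
    {z : ℝ} {t : m → ℝ} (hα : ∀ k, 0 < α k) (hz : ∀ k, μ k < z)
    (ht : ∀ r, 2 * t r < z - ∑ k, α k / (z - μ k)) (i j : Option ι) :
    (of fun r s => arrowheadResolvent μ α z (t r + t s) i j).PosSemidef := by
  have hz' : ∀ k, 0 < z - μ k := fun k => sub_pos.2 (hz k)
  have hd : 0 ≤ diagonal (fun i : Option ι => i.elim 0 fun i => (z - μ i)⁻¹) i j := by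
    rw [diagonal_apply]
    split_ifs
    · rcases i with _ | i
      · exact le_rfl
      · exact (inv_pos.2 (hz' i)).le
    · exact le_rfl
  have hw : 0 ≤ vecMulVec (fun i : Option ι => i.elim 1 fun i => (z - μ i)⁻¹)
      (fun i : Option ι => i.elim 1 fun i => α i / (z - μ i)) i j := by
    refine mul_nonneg ?_ ?_
    · rcases i with _ | i
      · exact zero_le_one
      · exact (inv_pos.2 (hz' i)).le
    · rcases j with _ | j
      · exact zero_le_one
      · exact (div_pos (hα j) (hz' j)).le
  have hinv := posSemidef_inv_add (y := fun r => (z - ∑ k, α k / (z - μ k)) / 2 - t r)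
    fun r => by linarith [ht r]
  convert! (posSemidef_const hd).add (hinv.smul hw) using 1
  ext r s
  simp only [arrowheadResolvent, of_apply, Matrix.add_apply, Matrix.smul_apply, smul_eq_mul]
  rw [mul_comm (_⁻¹)]
  congr 3
  ring

theorem tendsto_mul_inv_sub_pow {c : ℝ} (hc : 0 < c) (x : ℝ) :
    Tendsto (fun p : ℕ => (p / c * (p / c - x)⁻¹) ^ p) atTop (𝓝 (Real.exp (c * x))) := by
  have h := (Real.tendsto_one_add_div_pow_exp (-(c * x))).inv₀ (Real.exp_pos _).ne'
  rw [Real.exp_neg, inv_inv] at h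
  refine h.congr' ?_
  filter_upwards [eventually_gt_atTop 0] with p hp
  have hp' : (p : ℝ) ≠ 0 := Nat.cast_ne_zero.2 hp.ne'
  rw [← inv_pow]
  congr 1
  rw [← _root_.inv_inj, inv_inv, mul_inv, inv_inv]
  field_simp
  ring

theorem eventually_add_lt_sub_sum_div [Fintype ι] (μ α : ι → ℝ) (hα : ∀ k, 0 < α k) (a : ℝ) :
    ∀ᶠ z in atTop, a < z - ∑ k, α k / (z - μ k) := by
  have h : ∀ᶠ z in atTop, ∀ k, μ k + 1 < z := eventually_all.2 fun k => eventually_gt_atTop _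
  filter_upwards [h, eventually_gt_atTop (a + ∑ k, α k)] with z hz hza
  have : ∑ k, α k / (z - μ k) ≤ ∑ k, α k :=
    Finset.sum_le_sum fun k _ => div_le_self (hα k).le (by linarith [hz k])
  linarith

variable [Fintype ι] [DecidableEq ι] {ν : ℝ → Option ι → ℝ}
  {m : Type*} [Fintype m]

theorem posSemidef_sum_exp_mul_of_pos (hα : ∀ k, 0 < α k) (hinj : ∀ t, Function.Injective (ν t))
    (hνμ : ∀ t i k, ν t i ≠ μ k) (hν : ∀ t i, ν t i - t = ∑ k, α k / (ν t i - μ k))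
    {c : ℝ} (hc : 0 < c) (t : m → ℝ) :
    (of fun r s => ∑ k, Real.exp (c * ν (t r + t s) k)).PosSemidef := by
  have hlim : Tendsto (fun p : ℕ => (p : ℝ) / c) atTop atTop :=
    tendsto_natCast_atTop_atTop.atTop_div_const hc
  refine posSemidef_of_tendsto (l := atTop)
    (M := fun p => of fun r s => ∑ k, (p / c * (p / c - ν (t r + t s) k)⁻¹) ^ p) ?_
    fun r s => tendsto_finsetSum _ fun k _ => tendsto_mul_inv_sub_pow hc _
  filter_upwards [hlim.eventually (eventually_all.2 fun k => eventually_gt_atTop (μ k)),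
    hlim.eventually (eventually_all.2 fun r => eventually_add_lt_sub_sum_div μ α hα (2 * t r))]
    with p hz ht
  have hp : (0 : ℝ) ≤ p / c := by positivity
  have hsum := (posSemidef_sum Finset.univ fun i (_ : i ∈ Finset.univ) =>
    posSemidef_pow_apply (posSemidef_arrowheadResolvent_apply hα hz ht) p i i).smul
      (pow_nonneg hp p)
  convert! hsum using 1
  ext r s
  have htrace := trace_pow_eq_sum (M := arrowheadResolvent μ α (p / c) (t r + t s))
    (inv_injective.comp (sub_right_injective.comp (hinj (t r + t s))))
    (fun k => arrowheadEigenvector_ne_zero _)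
    (fun k => arrowheadResolvent_mulVec_eigenvector (hνμ _ k) (fun i => (hz i).ne') (hν _ k)
      (by linarith [ht r, ht s])) p
  simp only [Matrix.smul_apply, Matrix.sum_apply, of_apply, smul_eq_mul, mul_pow, ← Finset.mul_sum]
  rw [Matrix.trace] at htrace
  simp only [diag_apply, Function.comp_apply] at htrace
  rw [htrace]

theorem posSemidef_sum_exp_mul (hα : ∀ k, 0 < α k) (hinj : ∀ t, Function.Injective (ν t))
    (hνμ : ∀ t i k, ν t i ≠ μ k) (hν : ∀ t i, ν t i - t = ∑ k, α k / (ν t i - μ k))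
    (c : ℝ) (t : m → ℝ) :
    (of fun r s => ∑ k, Real.exp (c * ν (t r + t s) k)).PosSemidef := by
  rcases lt_trichotomy c 0 with hc | rfl | hc
  · have h := posSemidef_sum_exp_mul_of_pos (μ := -μ) (ν := fun t i => -ν (-t) i) hα
      (fun t => neg_injective.comp (hinj (-t))) (fun t i k => by simpa using hνμ (-t) i k)
      (fun t i => ?_) (neg_pos.2 hc) (-t)
    · simpa [← neg_add_rev, add_comm] using h
    · have h := congrArg Neg.neg (hν (-t) i)
      rw [← Finset.sum_neg_distrib] at h
      convert! h using 1
      · ring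
      · refine Finset.sum_congr rfl fun k _ => ?_
        rw [← div_neg, Pi.neg_apply]
        congr 1
        ring
  · simpa using posSemidef_const (m := m) (Nat.cast_nonneg (α := ℝ) (Fintype.card (Option ι)))
  · exact posSemidef_sum_exp_mul_of_pos hα hinj hνμ hν hc t

theorem integral_exp_mul_gaussianReal {γ : ℝ} (hγ : 0 < γ) (x : ℝ) :
    ∫ c, Real.exp (c * x) ∂gaussianReal 0 (2 * γ).toNNReal = Real.exp (γ * x ^ 2) := by
  have h := mgf_gaussianReal (p := gaussianReal 0 (2 * γ).toNNReal) (X := id) Measure.map_id x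
  rw [Real.coe_toNNReal _ (by positivity)] at h
  simp only [mgf, id] at h
  simp only [mul_comm _ x]
  rw [h]
  congr 1
  ring

theorem posSemidef_sum_exp_mul_sq (hα : ∀ k, 0 < α k) (hinj : ∀ t, Function.Injective (ν t))
    (hνμ : ∀ t i k, ν t i ≠ μ k) (hν : ∀ t i, ν t i - t = ∑ k, α k / (ν t i - μ k))
    {γ : ℝ} (hγ : 0 < γ) (t : m → ℝ) :
    (of fun r s => ∑ k, Real.exp (γ * ν (t r + t s) k ^ 2)).PosSemidef := by
  have h_int : ∀ x : ℝ, Integrable (fun c => Real.exp (c * x)) (gaussianReal 0 (2 * γ).toNNReal) :=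
    fun x => by simpa only [mul_comm x] using integrable_exp_mul_gaussianReal x
  have h := posSemidef_integral (fun c => posSemidef_sum_exp_mul hα hinj hνμ hν c t)
    fun r s => integrable_finsetSum _ fun k _ => h_int (ν (t r + t s) k)
  convert! h using 1
  ext r s
  simp only [of_apply]
  rw [integral_finsetSum _ fun k _ => h_int _]
  exact Finset.sum_congr rfl fun k _ => (integral_exp_mul_gaussianReal hγ _).symm

theorem continuous_sum_exp_mul_sq (hinj : ∀ t, Function.Injective (ν t))
    (hνμ : ∀ t i k, ν t i ≠ μ k) (hν : ∀ t i, ν t i - t = ∑ k, α k / (ν t i - μ k)) (γ : ℝ) :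
    Continuous fun t => ∑ k, Real.exp (γ * ν t k ^ 2) := by
  convert! continuous_trace_exp_smul_sq (continuous_arrowhead (μ := μ) (α := α)) γ using 2 with t
  exact (trace_exp_smul_sq_eq_sum (hinj t) (fun k => arrowheadEigenvector_ne_zero _)
    (fun k => arrowhead_mulVec_eigenvector (hνμ t k) (hν t k)) γ).symm

theorem expConvexOn_sum_exp_mul_sq (hα : ∀ k, 0 < α k) (hinj : ∀ t, Function.Injective (ν t))
    (hνμ : ∀ t i k, ν t i ≠ μ k) (hν : ∀ t i, ν t i - t = ∑ k, α k / (ν t i - μ k))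
    {γ : ℝ} (hγ : 0 < γ) :
    ExpConvexOn (fun t => ∑ k, Real.exp (γ * ν t k ^ 2)) Set.univ :=
  ⟨(continuous_sum_exp_mul_sq hinj hνμ hν γ).continuousOn, fun _ t _ ζ =>
    complex_quadraticForm_nonneg (posSemidef_sum_exp_mul_sq hα hinj hνμ hν hγ t) ζ⟩

end Arrowhead

section Roots

variable {ι : Type*} [Fintype ι] [DecidableEq ι] {μ α : ι → ℝ} {x t : ℝ}

theorem ne_of_secular_root (hμ : Function.Injective μ) (hα : ∀ k, 0 < α k)
    (h : x * ∏ k, (x - μ k) - ∑ k, α k * ∏ j ∈ Finset.univ.erase k, (x - μ j) -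
      t * ∏ k, (x - μ k) = 0) (k : ι) : x ≠ μ k := by
  rintro rfl
  rw [Finset.prod_eq_zero (Finset.mem_univ k) (sub_self _), mul_zero, mul_zero, zero_sub, sub_zero,
    neg_eq_zero, Finset.sum_eq_single k] at h
  · refine (mul_ne_zero (hα k).ne' (Finset.prod_ne_zero_iff.2 fun j hj => ?_)) h
    exact sub_ne_zero.2 (hμ.ne (Finset.ne_of_mem_erase hj).symm)
  · intro i _ hi
    rw [Finset.prod_eq_zero (Finset.mem_erase.2 ⟨hi.symm, Finset.mem_univ k⟩) (sub_self _),
      mul_zero]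
  · exact fun hk => absurd (Finset.mem_univ k) hk

theorem sub_eq_sum_of_secular_root (hx : ∀ k, x ≠ μ k)
    (h : x * ∏ k, (x - μ k) - ∑ k, α k * ∏ j ∈ Finset.univ.erase k, (x - μ j) -
      t * ∏ k, (x - μ k) = 0) : x - t = ∑ k, α k / (x - μ k) := by
  have hprod : ∏ k, (x - μ k) ≠ 0 := Finset.prod_ne_zero_iff.2 fun k _ => sub_ne_zero.2 (hx k)
  refine mul_right_cancel₀ hprod ?_
  have hsum : (∑ k, α k / (x - μ k)) * ∏ k, (x - μ k) =
      ∑ k, α k * ∏ j ∈ Finset.univ.erase k, (x - μ j) := by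
    rw [Finset.sum_mul]
    refine Finset.sum_congr rfl fun k _ => ?_
    rw [← Finset.mul_prod_erase _ _ (Finset.mem_univ k), ← mul_assoc,
      div_mul_cancel₀ _ (sub_ne_zero.2 (hx k))]
  rw [hsum]
  linear_combination h

end Roots

end ExponentialConvexity

theorem stmt_2 (n : ℕ) (hn : 1 ≤ n) (μ α : Fin n → ℝ)
    (hμ : ∀ i j : Fin n, i < j → μ j < μ i) (hα : ∀ k, 0 < α k)
    (Q P : Polynomial ℝ)
    (hQ : Q = ∏ k, (X - C (μ k)))
    (hP : P = X * Q - ∑ k, C (α k) * ∏ j ∈ Finset.univ.erase k, (X - C (μ j)))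
    (ν : ℝ → Fin (n + 1) → ℝ)
    (hνroot : ∀ t k, (P - C t * Q).eval (ν t k) = 0)
    (hνanti : ∀ t, StrictAnti (ν t))
    (γ : ℝ) (hγ : 0 < γ) :
    ExpConvexOn (fun t => ∑ k, Real.exp (γ * (ν t k) ^ 2)) Set.univ := by
  have hμ' : Function.Injective μ := StrictAnti.injective fun i j hij => hμ i j hij
  have h : ∀ t i, ν t i * ∏ k, (ν t i - μ k) -
      ∑ k, α k * ∏ j ∈ Finset.univ.erase k, (ν t i - μ j) - t * ∏ k, (ν t i - μ k) = 0 := by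
    intro t i
    simpa [hP, hQ, eval_prod, eval_finsetSum] using hνroot t i
  have hνμ : ∀ t i k, ν t i ≠ μ k := fun t i => ne_of_secular_root hμ' hα (h t i)
  have hν : ∀ t i, ν t i - t = ∑ k, α k / (ν t i - μ k) := fun t i =>
    sub_eq_sum_of_secular_root (hνμ t i) (h t i)
  have key := expConvexOn_sum_exp_mul_sq (ν := fun t i => ν t ((finSuccEquiv n).symm i)) hα
    (fun t => (hνanti t).injective.comp (finSuccEquiv n).symm.injective)
    (fun t i => hνμ t _) (fun t i => hν t _) hγ
  convert! key using 2 with t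
  exact (Equiv.sum_comp (finSuccEquiv n).symm fun k => Real.exp (γ * ν t k ^ 2)).symm
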